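/- arXiv:0907.2748 — 2 statements merged into one kernel-verified Lean document; each statement's English description precedes it below -/
import Mathlib

section
/- For each fixed x > 0, as n → ∞ the upper bound sequence (h_n(x)/g_n(x)) exp(-x²/2) is decreasing and converges to ∫_x^∞ exp(-t²/2) dt. -/
open Nat Finset MeasureTheory Real

noncomputable def gp (n : ℕ) (x : ℝ) : ℝ :=
  ∑ i ∈ Finset.range (n+1), ((2*n+1)! : ℝ) / ((2*(n-i))‼ * (2*i+1)!) * x^(2*i+1)

noncomputable def hp (n : ℕ) (x : ℝ) : ℝ :=
  ∑ i ∈ Finset.range (n+1), ((n+i)! * (n-i)! : ℝ) / ((2*(n-i))‼ * (2*i)!) *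
    (∑ j ∈ Finset.range (n-i+1), ((2*n+1).choose j : ℝ)) * x^(2*i)

noncomputable def evS (c : ℕ → ℕ → ℝ) (x : ℝ) (n : ℕ) : ℝ :=
  ∑ i ∈ Finset.range (n+1), c (n-i) (2*i) * x^(2*i)

noncomputable def odS (c : ℕ → ℕ → ℝ) (x : ℝ) (n : ℕ) : ℝ :=
  ∑ i ∈ Finset.range (n+1), c (n-i) (2*i+1) * x^(2*i+1)

lemma odS_succ (c : ℕ → ℕ → ℝ) (a : ℕ → ℝ) (x : ℝ)
    (h0 : ∀ k, c 0 (k+1) = c 0 k)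
    (h : ∀ l k, c (l+1) (k+1) = c (l+1) k + a (2*l+k+3) * c l (k+1)) (n : ℕ) :
    odS c x (n+1) = x * evS c x (n+1) + a (2*n+3) * odS c x n := by
  unfold odS evS
  rw [Finset.sum_range_succ, Finset.sum_range_succ (n := n+1), mul_add x, Finset.mul_sum, Finset.mul_sum]
  have : ∀ i ∈ Finset.range (n+1), c (n+1-i) (2*i+1) * x^(2*i+1)
      = x * (c (n+1-i) (2*i) * x^(2*i)) + a (2*n+3) * (c (n-i) (2*i+1) * x^(2*i+1)) := by
    intro i hi
    obtain ⟨k, rfl⟩ : ∃ k, n = i + k := ⟨n - i, by simp at hi; omega⟩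
    rw [show i + k + 1 - i = k + 1 by omega, show i + k - i = k by omega, h,
      show 2*k+2*i+3 = 2*(i+k)+3 by ring]
    ring
  rw [Finset.sum_congr rfl this, Finset.sum_add_distrib]
  simp only [Nat.sub_self, h0]
  ring

lemma evS_succ (c : ℕ → ℕ → ℝ) (a : ℕ → ℝ) (x : ℝ)
    (h0 : ∀ k, c 0 (k+1) = c 0 k)
    (hb : ∀ l, c (l+1) 0 = a (2*l+2) * c l 0)
    (h : ∀ l k, c (l+1) (k+1) = c (l+1) k + a (2*l+k+3) * c l (k+1)) (n : ℕ) :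
    evS c x (n+1) = x * odS c x n + a (2*n+2) * evS c x n := by
  unfold odS evS
  rw [Finset.sum_range_succ', Finset.sum_range_succ, Finset.sum_range_succ (n := n),
    Finset.sum_range_succ' (n := n), mul_add x, mul_add (a _), Finset.mul_sum, Finset.mul_sum]
  have : ∀ i ∈ Finset.range n, c (n+1-(i+1)) (2*(i+1)) * x^(2*(i+1))
      = x * (c (n-i) (2*i+1) * x^(2*i+1)) + a (2*n+2) * (c (n-(i+1)) (2*(i+1)) * x^(2*(i+1))) := by
    intro i hi
    obtain ⟨k, rfl⟩ : ∃ k, n = i + k + 1 := ⟨n - i - 1, by simp at hi; omega⟩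
    rw [show i + k + 1 + 1 - (i + 1) = k + 1 by omega, show i + k + 1 - i = k + 1 by omega,
      show i + k + 1 - (i+1) = k by omega, show 2 * (i+1) = 2*i+1+1 by ring, h,
      show 2*k+(2*i+1)+3 = 2*(i+k+1)+2 by ring]
    ring
  rw [Finset.sum_congr rfl this, Finset.sum_add_distrib]
  simp only [Nat.sub_self, Nat.sub_zero, mul_zero, hb]
  rw [show 2 * (n+1) = 2*n+1+1 by ring, h0]
  ring

noncomputable def dS (N k : ℕ) : ℝ := ∑ j ∈ Finset.range (k+1), (N.choose j : ℝ)

lemma dS_succ (N k : ℕ) : dS (N+1) k + N.choose k = 2 * dS N k := by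
  induction k with
  | zero => simp [dS]; norm_num
  | succ k ih =>
    have e : ∀ M, dS M (k+1) = dS M k + M.choose (k+1) := fun M => Finset.sum_range_succ _ _
    rw [e, e, Nat.choose_succ_succ]
    push_cast
    linarith

lemma dS_key (l k : ℕ) : ((l:ℝ)+k+1) * dS (2*l+k+3) (l+1)
    = k * dS (2*l+k+2) (l+1) + 2*(2*l+k+2) * dS (2*l+k+1) l := by
  have h1 := dS_succ (2*l+k+2) (l+1)
  have h2 := dS_succ (2*l+k+1) (l+1)
  have e : dS (2*l+k+1) (l+1) = dS (2*l+k+1) l + (2*l+k+1).choose (l+1) :=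
    Finset.sum_range_succ _ _
  have h3 : ((2*l+k+2).choose (l+1) : ℝ) = (2*l+k+1).choose l + (2*l+k+1).choose (l+1) := by
    exact_mod_cast Nat.choose_succ_succ (2*l+k+1) l
  have h4 : ((2*l+k+1).choose (l+1) : ℝ) * (l+1) = (2*l+k+1).choose l * (l+k+1) := by
    have := Nat.choose_succ_right_eq (2*l+k+1) l
    rw [show 2*l+k+1-l = l+k+1 by omega] at this
    exact_mod_cast this
  have h1' : dS (2*l+k+3) (l+1) = 2 * dS (2*l+k+2) (l+1) - (2*l+k+2).choose (l+1) := by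
    linarith
  have h2' : dS (2*l+k+2) (l+1) = 2 * dS (2*l+k+1) (l+1) - (2*l+k+1).choose (l+1) := by
    linarith
  rw [h1', h2', h3, e]
  linear_combination h4

noncomputable def cH (l k : ℕ) : ℝ := ((l+k)! : ℝ) / (2^l * k !) * dS (2*l+k+1) l

noncomputable def cG (l k : ℕ) : ℝ := ((2*l+k)! : ℝ) / (2^l * l ! * k !)

lemma cH_zero (k : ℕ) : cH 0 k = 1 := by
  simp [cH, dS, Nat.factorial_ne_zero]

lemma cH_b (l : ℕ) : cH (l+1) 0 = ((2*l+2 : ℕ) : ℝ) * cH l 0 := by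
  have h : dS (2*l+3) (l+1) = 4 * dS (2*l+1) l := by
    have h := dS_key l 0
    have h0 : (l:ℝ) + 1 ≠ 0 := by positivity
    apply mul_left_cancel₀ h0
    push_cast at h
    simp only [add_zero] at h
    linear_combination h
  simp only [cH, Nat.factorial_succ, add_zero, Nat.factorial_zero]
  rw [show 2*(l+1)+1 = 2*l+3 by ring]
  push_cast
  have : (2:ℝ)^l ≠ 0 := by positivity
  rw [pow_succ]
  field_simp
  linear_combination h

lemma cH_rec (l k : ℕ) : cH (l+1) (k+1) = cH (l+1) k + ((2*l+k+3 : ℕ) : ℝ) * cH l (k+1) := by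
  have h := dS_key l (k+1)
  simp only [cH]
  rw [show l+1+(k+1) = l+k+1+1 by ring, show l+1+k = l+k+1 by ring, show l+(k+1) = l+k+1 by ring,
    Nat.factorial_succ (l+k+1), Nat.factorial_succ k,
    show 2*(l+1)+(k+1)+1 = 2*l+(k+1)+3 by ring, show 2*(l+1)+k+1 = 2*l+(k+1)+2 by ring]
  push_cast at h ⊢
  have : (2:ℝ)^l ≠ 0 := by positivity
  have : (k ! : ℝ) ≠ 0 := by positivity
  rw [pow_succ]
  field_simp
  linear_combination h

lemma cG_zero (k : ℕ) : cG 0 k = 1 := by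
  simp [cG, Nat.factorial_ne_zero]

lemma cG_b (l : ℕ) : cG (l+1) 0 = ((2*l+2 : ℕ) - 1 : ℝ) * cG l 0 := by
  simp only [cG]
  rw [show 2*(l+1)+0 = 2*l+0+1+1 by ring, Nat.factorial_succ, Nat.factorial_succ (2*l+0),
    Nat.factorial_succ l]
  push_cast
  have : (2:ℝ)^l ≠ 0 := by positivity
  have : (l ! : ℝ) ≠ 0 := by positivity
  rw [pow_succ]
  field_simp
  ring

lemma cG_rec (l k : ℕ) : cG (l+1) (k+1) = cG (l+1) k + ((2*l+k+3 : ℕ) - 1 : ℝ) * cG l (k+1) := by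
  simp only [cG]
  rw [show 2*(l+1)+(k+1) = 2*l+k+1+1+1 by ring, show 2*(l+1)+k = 2*l+k+1+1 by ring,
    show 2*l+(k+1) = 2*l+k+1 by ring, Nat.factorial_succ (2*l+k+1+1), 
    Nat.factorial_succ (2*l+k+1), Nat.factorial_succ l, Nat.factorial_succ k]
  push_cast
  have : (2:ℝ)^l ≠ 0 := by positivity
  have : (k ! : ℝ) ≠ 0 := by positivity
  have : (l ! : ℝ) ≠ 0 := by positivity
  rw [pow_succ]
  field_simp
  ring

lemma hp_eq (n : ℕ) (x : ℝ) : hp n x = evS cH x n := by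
  unfold hp evS cH dS
  refine Finset.sum_congr rfl fun i hi => ?_
  obtain ⟨k, rfl⟩ : ∃ k, n = i + k := ⟨n - i, by simp at hi; omega⟩
  rw [show i + k - i = k by omega, Nat.doubleFactorial_two_mul,
    show 2*k+2*i+1 = 2*(i+k)+1 by ring, show k + 2*i = i+k+i by ring]
  push_cast
  have : (k ! : ℝ) ≠ 0 := by positivity
  field_simp

lemma gp_eq (n : ℕ) (x : ℝ) : gp n x = odS cG x n := by
  unfold gp odS cG
  refine Finset.sum_congr rfl fun i hi => ?_
  obtain ⟨k, rfl⟩ : ∃ k, n = i + k := ⟨n - i, by simp at hi; omega⟩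
  rw [show i + k - i = k by omega, Nat.doubleFactorial_two_mul,
    show 2*k+(2*i+1) = 2*(i+k)+1 by ring]
  push_cast
  rfl

/-- three-term sequence. -/
noncomputable def rS (x p q : ℝ) : ℕ → ℝ
  | 0 => p
  | 1 => q
  | (m+2) => x * rS x p q (m+1) + (m+1) * rS x p q m

lemma G_eq (x : ℝ) (n : ℕ) : evS cG x n = rS x 1 x (2*n) ∧ odS cG x n = rS x 1 x (2*n+1) := by
  induction n with
  | zero => simp [evS, odS, rS, cG_zero]
  | succ n ih =>
    have h0 : ∀ k, cG 0 (k+1) = cG 0 k := fun k => by rw [cG_zero, cG_zero]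
    have e1 := evS_succ cG (fun m => (m:ℝ) - 1) x h0 cG_b cG_rec n
    have e2 := odS_succ cG (fun m => (m:ℝ) - 1) x h0 cG_rec n
    have r1 : rS x 1 x (2*(n+1)) = x * rS x 1 x (2*n+1) + ((2*n : ℕ) + 1) * rS x 1 x (2*n) := rfl
    have r2 : rS x 1 x (2*(n+1)+1) = x * rS x 1 x (2*(n+1)) + ((2*n+1 : ℕ) + 1) * rS x 1 x (2*n+1) := rfl
    have a1 : evS cG x (n+1) = rS x 1 x (2*(n+1)) := by
      rw [e1, r1, ih.1, ih.2]; push_cast; ring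
    refine ⟨a1, ?_⟩
    rw [e2, r2, a1, ih.2]; push_cast; ring

lemma H_eq (x : ℝ) (n : ℕ) : evS cH x n = rS x 0 1 (2*n+1) ∧ odS cH x n = rS x 0 1 (2*n+2) := by
  induction n with
  | zero => simp [evS, odS, rS, cH_zero]
  | succ n ih =>
    have h0 : ∀ k, cH 0 (k+1) = cH 0 k := fun k => by rw [cH_zero, cH_zero]
    have e1 := evS_succ cH (fun m => (m:ℝ)) x h0 cH_b cH_rec n
    have e2 := odS_succ cH (fun m => (m:ℝ)) x h0 cH_rec n
    have r1 : rS x 0 1 (2*(n+1)+1) = x * rS x 0 1 (2*n+2) + ((2*n+1 : ℕ) + 1) * rS x 0 1 (2*n+1) := rfl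
    have r2 : rS x 0 1 (2*(n+1)+2) = x * rS x 0 1 (2*(n+1)+1) + ((2*n+2 : ℕ) + 1) * rS x 0 1 (2*n+2) := rfl
    have a1 : evS cH x (n+1) = rS x 0 1 (2*(n+1)+1) := by
      rw [e1, r1, ih.1, ih.2]; push_cast; ring
    refine ⟨a1, ?_⟩
    rw [e2, r2, a1, ih.2]; push_cast; ring

lemma cas (x : ℝ) (m : ℕ) : rS x 0 1 m * rS x 1 x (m+1) - rS x 0 1 (m+1) * rS x 1 x m
    = (-1)^(m+1) * m ! := by
  induction m with
  | zero => simp [rS]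
  | succ m ih =>
    rw [Nat.factorial_succ]
    simp only [rS] at ih ⊢
    push_cast
    rw [pow_succ]
    linear_combination (-(m:ℝ)-1) * ih

lemma gp_pos (n : ℕ) {x : ℝ} (hx : 0 < x) : 0 < gp n x := by
  unfold gp
  apply Finset.sum_pos
  · intro i _
    have : 0 < (2*(n-i))‼ := Nat.doubleFactorial_pos _
    positivity
  · simp

noncomputable def iI (x : ℝ) (m : ℕ) : ℝ := ∫ t in Set.Ioi x, (t-x)^m * Real.exp (-t^2/2)

lemma iI_int {x : ℝ} (hx : 0 < x) (m : ℕ) :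
    IntegrableOn (fun t => (t-x)^m * Real.exp (-t^2/2)) (Set.Ioi x) := by
  have h := (integrable_rpow_mul_exp_neg_mul_sq (b := 1/2) (by norm_num) (s := m)
    (by have : (0:ℝ) ≤ m := Nat.cast_nonneg m
        linarith)).integrableOn (s := Set.Ioi x)
  refine Integrable.mono' h (by fun_prop) ?_
  refine (ae_restrict_iff' measurableSet_Ioi).2 (Filter.Eventually.of_forall fun t ht => ?_)
  have ht : x < t := ht
  rw [Real.norm_of_nonneg (by have := sub_pos.2 ht; positivity), Real.rpow_natCast,
    show -(1/2) * t^2 = -t^2/2 by ring]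
  have : (t-x)^m ≤ t^m := pow_le_pow_left₀ (by linarith) (by linarith) m
  gcongr

lemma iI_nonneg (x : ℝ) (m : ℕ) : 0 ≤ iI x m := by
  refine setIntegral_nonneg measurableSet_Ioi fun t ht => ?_
  have := sub_pos.2 (show x < t from ht)
  positivity

lemma iI_aux {x : ℝ} (hx : 0 < x) (m : ℕ) (f : ℝ → ℝ) (hf : IntegrableOn f (Set.Ioi x))
    (hd : ∀ t, HasDerivAt (fun t => (t-x)^m * Real.exp (-t^2/2)) (f t) t) :
    ∫ t in Set.Ioi x, f t = - ((x-x)^m * Real.exp (-x^2/2)) := by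
  rw [integral_Ioi_of_hasDerivAt_of_tendsto' (fun t _ => hd t) hf
    (tendsto_zero_of_hasDerivAt_of_integrableOn_Ioi (fun t _ => hd t) hf (iI_int hx m))]
  ring

lemma expd (t : ℝ) : HasDerivAt (fun t : ℝ => Real.exp (-t^2/2)) (Real.exp (-t^2/2) * (-t)) t := by
  have : HasDerivAt (fun t : ℝ => -t^2/2) (-t) t := by
    have h := (hasDerivAt_pow 2 t).neg.div_const 2
    refine HasDerivAt.congr_deriv h ?_
    norm_num
    ring
  exact this.exp

lemma iI_one {x : ℝ} (hx : 0 < x) : iI x 1 = Real.exp (-x^2/2) - x * iI x 0 := by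
  have i0 := iI_int hx 0
  have i1 := iI_int hx 1
  have := iI_aux hx 0 (fun t => -((t-x)^1 * Real.exp (-t^2/2)) - x * ((t-x)^0 * Real.exp (-t^2/2)))
    (i1.neg.sub (i0.const_mul x)) (fun t => by
      simp only [pow_zero, one_mul]
      convert expd t using 1
      ring)
  have e := integral_sub (f := fun t => -((t-x)^1 * Real.exp (-t^2/2))) i1.neg (i0.const_mul x)
  rw [e, integral_neg, integral_const_mul] at this
  simp only [iI]
  simp only [pow_zero, one_mul] at this ⊢
  linarith

lemma iI_rec {x : ℝ} (hx : 0 < x) (m : ℕ) : iI x (m+2) = (m+1) * iI x m - x * iI x (m+1) := by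
  have i0 := iI_int hx m
  have i1 := iI_int hx (m+1)
  have i2 := iI_int hx (m+2)
  have := iI_aux hx (m+1) (fun t => (m+1) * ((t-x)^m * Real.exp (-t^2/2))
      - x * ((t-x)^(m+1) * Real.exp (-t^2/2)) - (t-x)^(m+2) * Real.exp (-t^2/2))
    (((i0.const_mul _).sub (i1.const_mul x)).sub i2) (fun t => by
      have h := (((hasDerivAt_id t).sub_const x).pow (m+1)).mul (expd t)
      refine HasDerivAt.congr_deriv h ?_
      simp only [Pi.pow_apply, id, Nat.add_sub_cancel]
      push_cast
      ring)
  have e := integral_sub (f := fun t => (m+1) * ((t-x)^m * Real.exp (-t^2/2))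
      - x * ((t-x)^(m+1) * Real.exp (-t^2/2))) ((i0.const_mul _).sub (i1.const_mul x)) i2
  rw [e,
    integral_sub (i0.const_mul _) (i1.const_mul x), integral_const_mul, integral_const_mul] at this
  simp only [iI]
  simp only [sub_self, ne_eq, Nat.add_eq_zero_iff, one_ne_zero, and_false, not_false_eq_true, zero_pow, zero_mul, neg_zero] at this
  linarith

lemma iI_eq {x : ℝ} (hx : 0 < x) (m : ℕ) :
    (iI x m = (-1)^m * (rS x 1 x m * iI x 0 - rS x 0 1 m * Real.exp (-x^2/2))) ∧
    (iI x (m+1) = (-1)^(m+1) * (rS x 1 x (m+1) * iI x 0 - rS x 0 1 (m+1) * Real.exp (-x^2/2))) := by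
  induction m with
  | zero => 
    refine ⟨by simp [rS], ?_⟩
    rw [iI_one hx]; simp [rS]
  | succ m ih =>
    refine ⟨ih.2, ?_⟩
    rw [iI_rec hx, ih.2, ih.1]
    simp only [rS]
    ring

lemma iI_le {x : ℝ} (hx : 0 < x) (n : ℕ) : iI x (2*n+1) ≤ 2^n * n ! := by
  induction n with
  | zero =>
    simp only [mul_zero, zero_add, pow_zero, Nat.factorial_zero, Nat.cast_one, mul_one]
    rw [iI_one hx]
    have := mul_nonneg hx.le (iI_nonneg x 0)
    have h2 : Real.exp (-x^2/2) ≤ 1 := Real.exp_le_one_iff.2 (by nlinarith)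
    linarith
  | succ n ih =>
    rw [show 2*(n+1)+1 = 2*n+1+2 by ring, iI_rec hx, Nat.factorial_succ]
    have := mul_nonneg hx.le (iI_nonneg x (2*n+1+1))
    push_cast
    rw [pow_succ]
    have h2 : (2*(n:ℝ)+2) * iI x (2*n+1) ≤ (2*(n:ℝ)+2) * (2^n * n !) := by gcongr
    linarith

lemma cG_lb (n : ℕ) : (2:ℝ)^n * n ! ≤ cG n 1 := by
  induction n with
  | zero => simp [cG]
  | succ n ih =>
    have h : cG (n+1) 1 = (2*n+3) * cG n 1 := by
      simp only [cG]
      rw [show 2*(n+1)+1 = 2*n+1+1+1 by ring, Nat.factorial_succ, Nat.factorial_succ (2*n+1), Nat.factorial_succ n]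
      push_cast
      have : (2:ℝ)^n ≠ 0 := by positivity
      have : (n ! : ℝ) ≠ 0 := by positivity
      rw [pow_succ]
      field_simp
      ring
    rw [h, pow_succ, Nat.factorial_succ]
    push_cast
    have : 0 ≤ (2:ℝ)^n * n ! := by positivity
    nlinarith [mul_le_mul_of_nonneg_left ih (by positivity : (0:ℝ) ≤ 2*n+3)]

lemma gp_lb (n : ℕ) {x : ℝ} (hx : 0 < x) : (n+1) * x^3/3 * (2^(n+1) * (n+1)!) ≤ gp (n+1) x := by
  rw [gp_eq]
  unfold odS
  have h1 : cG n 3 * x^3 ≤ ∑ i ∈ Finset.range (n+1+1), cG (n+1-i) (2*i+1) * x^(2*i+1) := by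
    refine le_trans (by simp) (Finset.single_le_sum (f := fun i => cG (n+1-i) (2*i+1) * x^(2*i+1)) (fun i _ => ?_)
      (show 1 ∈ Finset.range (n+1+1) by simp))
    unfold cG
    positivity
  refine le_trans ?_ h1
  have h2 : cG n 3 = (2*n+3)*(n+1)/3 * cG n 1 := by
    simp only [cG]
    rw [Nat.factorial_succ (2*n+2), Nat.factorial_succ (2*n+1), show (3)! = 6 from rfl]
    push_cast
    have : (2:ℝ)^n ≠ 0 := by positivity
    have : (n ! : ℝ) ≠ 0 := by positivity
    simp
    field_simp
    ring
  rw [h2]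
  have h3 := cG_lb n
  have h4 : (2*n+2)*(n+1)/3 * ((2:ℝ)^n * n !) ≤ (2*n+3)*(n+1)/3 * cG n 1 := by
    have : (0:ℝ) ≤ 2^n * n ! := by positivity
    gcongr
    norm_num
  calc _ = (2*n+2)*(n+1)/3 * ((2:ℝ)^n * n !) * x^3 := by
        rw [pow_succ, Nat.factorial_succ]; push_cast; ring
    _ ≤ _ := by gcongr

theorem stmt14 (x : ℝ) (hx : 0 < x) :
    Antitone (fun n : ℕ => hp n x / gp n x * Real.exp (-x^2/2)) ∧
    Filter.Tendsto (fun n : ℕ => hp n x / gp n x * Real.exp (-x^2/2))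
      Filter.atTop (nhds (∫ t in Set.Ioi x, Real.exp (-t^2/2))) := by
  have hg : ∀ n, gp n x = rS x 1 x (2*n+1) := fun n => by rw [gp_eq, (G_eq x n).2]
  have hh : ∀ n, hp n x = rS x 0 1 (2*n+1) := fun n => by rw [hp_eq, (H_eq x n).1]
  constructor
  · refine antitone_nat_of_succ_le fun n => ?_
    have p1 := gp_pos n hx
    have p2 := gp_pos (n+1) hx
    refine mul_le_mul_of_nonneg_right ?_ (Real.exp_pos _).le
    rw [div_le_div_iff₀ p2 p1, hg, hg, hh, hh]
    have c := cas x (2*n+1)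
    rw [show (-1:ℝ)^(2*n+1+1) = 1 from Even.neg_one_pow ⟨n+1, by ring⟩, one_mul] at c
    have f : 0 ≤ x * ((2*n+1)! : ℝ) := by positivity
    rw [show 2*(n+1)+1 = 2*n+1+2 by ring]
    simp only [rS] at c ⊢
    rw [← c] at f
    linarith
  · have i0 : (∫ t in Set.Ioi x, Real.exp (-t^2/2)) = iI x 0 := by simp [iI]
    have key : ∀ n, hp n x / gp n x * Real.exp (-x^2/2) = iI x 0 + iI x (2*n+1) / gp n x := by
      intro n
      have p1 := (gp_pos n hx).ne'
      have := (iI_eq hx (2*n+1)).1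
      rw [← hg, ← hh, show (-1:ℝ)^(2*n+1) = -1 from Odd.neg_one_pow ⟨n, rfl⟩] at this
      rw [this]
      field_simp
      ring
    rw [i0]
    simp only [key]
    suffices h : Filter.Tendsto (fun n : ℕ => iI x (2*n+1) / gp n x) Filter.atTop (nhds 0) by
      simpa using h.const_add (iI x 0)
    rw [← Filter.tendsto_add_atTop_iff_nat 1]
    refine squeeze_zero (g := fun n : ℕ => 3/x^3 * (1/((n:ℝ)+1)))
      (fun n => div_nonneg (iI_nonneg _ _) (gp_pos _ hx).le) (fun n => ?_) ?_
    · have a1 := iI_le hx (n+1)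
      have a2 := gp_lb n hx
      rw [div_le_iff₀ (gp_pos _ hx)]
      refine a1.trans ?_
      have a3 := mul_le_mul_of_nonneg_left a2 (by positivity : 0 ≤ 3/x^3 * (1/((n:ℝ)+1)))
      refine le_trans (le_of_eq ?_) a3
      field_simp
    · simpa using (tendsto_one_div_add_atTop_nhds_zero_nat (𝕜 := ℝ)).const_mul (3/x^3)
end

section
/- For every integer n ≥ 1, every x > 0, and every integer k with 1 ≤ k ≤ n, the error in the Gaussian tail lower bound satisfies ∫_x^∞ exp(-t²/2) dt - ((h'_{n-1}(x) + g_{n-1}(x)) / (g'_{n-1}(x) + x g_{n-1}(x))) exp(-x²/2) < √(2π) (2k)! (n-k)! / (x^{2k} 2^{3k} n!). -/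
open Nat Finset MeasureTheory Real

noncomputable def ca (m i : ℕ) : ℝ := ((2*m+1)! : ℝ) / ((2*(m-i))‼ * (2*i+1)!)
noncomputable def cb (m i : ℕ) : ℝ := ((m+i)! * (m-i)! : ℝ) / ((2*(m-i))‼ * (2*i)!) *
    (∑ j ∈ Finset.range (m-i+1), ((2*m+1).choose j : ℝ))

lemma ca_pos (m i : ℕ) : 0 < ca m i := by
  unfold ca
  have := Nat.doubleFactorial_pos (2*(m-i))
  positivity

lemma cb_nonneg (m i : ℕ) : 0 ≤ cb m i := by
  unfold cb
  positivity

lemma ca_rec (m i : ℕ) (h : i < m) :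
    ((2*i+3 : ℝ)) * (2*i+2) * ca m (i+1) = 2 * (m - i) * ca m i := by
  obtain ⟨d, rfl⟩ := Nat.exists_eq_add_of_lt h
  unfold ca
  rw [show i + d + 1 - (i+1) = d by omega, show i + d + 1 - i = d + 1 by omega]
  rw [Nat.doubleFactorial_two_mul, Nat.doubleFactorial_two_mul]
  rw [show 2 * (i+1) + 1 = (2*i+1) + 1 + 1 by ring, Nat.factorial_succ (2*i+1+1), Nat.factorial_succ (2*i+1), Nat.factorial_succ d]
  push_cast
  field_simp
  ring

lemma cb_rec (m i : ℕ) (h : i < m) :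
    ((2*i+2 : ℝ)) * (2*i+1) * cb m (i+1) = (2*i+2*m+2) * cb m i - 2 * (2*i+1) * ca m i := by
  obtain ⟨d, rfl⟩ := Nat.exists_eq_add_of_lt h
  unfold ca cb
  rw [show i + d + 1 - (i+1) = d by omega, show i + d + 1 - i = d + 1 by omega]
  rw [Nat.doubleFactorial_two_mul, Nat.doubleFactorial_two_mul]
  rw [Finset.sum_range_succ _ (d+1)]
  have hc : (((2*(i+d+1)+1).choose (d+1) : ℕ) : ℝ) = ((2*(i+d+1)+1)! : ℝ) / ((d+1)! * (2*i+d+1+1)!) := by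
    rw [Nat.cast_choose ℝ (by omega)]
    congr 3
    congr 1
    omega
  rw [hc]
  generalize (∑ j ∈ Finset.range (d+1), ((2*(i+d+1)+1).choose j : ℝ)) = S
  rw [show 2 * (i+1) = (2*i) + 1 + 1 by ring, show i+d+1+(i+1) = 2*i+d+1+1 by ring, show i+d+1+i = 2*i+d+1 by ring,
    Nat.factorial_succ (2*i+1), Nat.factorial_succ (2*i), Nat.factorial_succ d, Nat.factorial_succ (2*i+d+1)]
  push_cast
  have h1 : (0:ℝ) < 2*i+d+1+1 := by positivity
  field_simp
  ring

lemma cab_last (m : ℕ) : (4*m+2) * cb m m = 2 * (2*m+1) * ca m m := by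
  unfold ca cb
  simp [← two_mul, Nat.doubleFactorial]
  field_simp
  ring

lemma ca_zero_sq (m : ℕ) : (2*m+2)*(2*m+1)! / (ca m 0)^2 = 4^(m+1) * ((m+1)! : ℝ)^2 / (2*(m+1))! := by
  unfold ca
  simp only [Nat.sub_zero, Nat.doubleFactorial_two_mul]
  rw [show 2 * (m+1) = 2*m+1+1 by ring, Nat.factorial_succ m, Nat.factorial_succ (2*m+1)]
  push_cast
  simp
  field_simp
  rw [show (4:ℝ)^(m+1) = 4 * (2^m)^2 by rw [pow_succ, ← pow_mul, mul_comm m 2, pow_mul]; norm_num; ring]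
  ring

lemma cb_ca_zero (m : ℕ) : cb m 0 * ca m 0 = (2*m+1)! := by
  have h := Nat.sum_range_choose_halfway m
  have h' : (∑ j ∈ Finset.range (m+1), ((2*m+1).choose j : ℝ)) = 4^m := by exact_mod_cast h
  unfold ca cb
  simp only [Nat.sub_zero, Nat.doubleFactorial_two_mul, h']
  simp
  rw [show (4:ℝ) = 2^2 by norm_num]
  field_simp
  rw [← pow_mul, ← pow_mul, mul_comm]

noncomputable def g1 (m : ℕ) (x : ℝ) : ℝ := ∑ i ∈ Finset.range (m+1), ca m i * ((2*i+1) * x^(2*i))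
noncomputable def g2 (m : ℕ) (x : ℝ) : ℝ := ∑ i ∈ Finset.range (m+1), ca m i * ((2*i+1) * ((2*i) * x^(2*i-1)))
noncomputable def h1 (m : ℕ) (x : ℝ) : ℝ := ∑ i ∈ Finset.range (m+1), cb m i * ((2*i) * x^(2*i-1))
noncomputable def h2 (m : ℕ) (x : ℝ) : ℝ := ∑ i ∈ Finset.range (m+1), cb m i * ((2*i) * ((2*i-1) * x^(2*i-2)))

lemma gp_eq_s16 (m : ℕ) (x : ℝ) : gp m x = ∑ i ∈ Finset.range (m+1), ca m i * x^(2*i+1) := rfl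
lemma hp_eq_s16 (m : ℕ) (x : ℝ) : hp m x = ∑ i ∈ Finset.range (m+1), cb m i * x^(2*i) := rfl

lemma hd_g (m : ℕ) (x : ℝ) : HasDerivAt (gp m) (g1 m x) x := by
  have : HasDerivAt (fun y => ∑ i ∈ Finset.range (m+1), ca m i * y^(2*i+1)) (g1 m x) x := by
    refine HasDerivAt.fun_sum fun i _ => HasDerivAt.const_mul _ ?_
    simpa using hasDerivAt_pow (2*i+1) x
  exact this

lemma hd_g1 (m : ℕ) (x : ℝ) : HasDerivAt (g1 m) (g2 m x) x := by
  refine HasDerivAt.fun_sum fun i _ => HasDerivAt.const_mul _ (HasDerivAt.const_mul _ ?_)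
  simpa using hasDerivAt_pow (2*i) x

lemma hd_h (m : ℕ) (x : ℝ) : HasDerivAt (hp m) (h1 m x) x := by
  have : HasDerivAt (fun y => ∑ i ∈ Finset.range (m+1), cb m i * y^(2*i)) (h1 m x) x := by
    refine HasDerivAt.fun_sum fun i _ => HasDerivAt.const_mul _ ?_
    simpa using hasDerivAt_pow (2*i) x
  exact this

lemma hd_h1 (m : ℕ) (x : ℝ) : HasDerivAt (h1 m) (h2 m x) x := by
  refine HasDerivAt.fun_sum fun i _ => HasDerivAt.const_mul _ ?_
  rcases i with _ | i
  · simpa using hasDerivAt_const x (0:ℝ)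
  · refine HasDerivAt.const_mul _ ?_
    convert! hasDerivAt_pow (2*(i+1)-1) x using 1
    rw [show 2*(i+1)-1 = 2*i+1 by omega, show 2*(i+1)-2 = 2*i by omega]
    push_cast
    simp
    left
    ring

lemma g_ode (m : ℕ) (x : ℝ) : g2 m x = (2*m+1) * gp m x - x * g1 m x := by
  have e : (2*m+1) * gp m x - x * g1 m x = ∑ i ∈ Finset.range (m+1), 2 * ((m:ℝ) - i) * ca m i * x^(2*i+1) := by
    rw [gp_eq_s16, g1, Finset.mul_sum, Finset.mul_sum, ← Finset.sum_sub_distrib]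
    refine Finset.sum_congr rfl fun i _ => ?_
    ring
  rw [e, Finset.sum_range_succ, g2, Finset.sum_range_succ']
  simp
  refine Finset.sum_congr rfl fun i hi => ?_
  rw [← ca_rec m i (Finset.mem_range.1 hi), show 2*(i+1)-1 = 2*i+1 by omega]
  ring

lemma h_ode (m : ℕ) (x : ℝ) : h2 m x = x * h1 m x + (2*m+2) * hp m x - 2 * g1 m x := by
  have e : x * h1 m x + (2*m+2) * hp m x - 2 * g1 m x =
      ∑ i ∈ Finset.range (m+1), ((2*i+2*m+2) * cb m i - 2 * (2*i+1) * ca m i) * x^(2*i) := by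
    rw [hp_eq_s16, h1, g1, Finset.mul_sum, Finset.mul_sum, Finset.mul_sum, ← Finset.sum_add_distrib, ← Finset.sum_sub_distrib]
    refine Finset.sum_congr rfl fun i _ => ?_
    rcases i with _ | i
    · simp
    · rw [show 2*(i+1)-1 = 2*i+1 by omega]
      push_cast
      ring
  rw [e, Finset.sum_range_succ, h2, Finset.sum_range_succ']
  have := cab_last m
  rw [show (2*m+2*m+2:ℝ) * cb m m - 2 * (2*m+1) * ca m m = 0 by linarith]
  simp
  refine Finset.sum_congr rfl fun i hi => ?_
  rw [← cb_rec m i (Finset.mem_range.1 hi), show 2*(i+1)-2 = 2*i by omega]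
  ring

lemma gp_nonneg (m : ℕ) (x : ℝ) (hx : 0 ≤ x) : 0 ≤ gp m x := by
  rw [gp_eq_s16]
  exact Finset.sum_nonneg fun i _ => mul_nonneg (ca_pos m i).le (by positivity)

lemma h1_nonneg (m : ℕ) (x : ℝ) (hx : 0 ≤ x) : 0 ≤ h1 m x :=
  Finset.sum_nonneg fun i _ => mul_nonneg (cb_nonneg m i) (by positivity)

lemma gp_zero (m : ℕ) : gp m 0 = 0 := by rw [gp_eq_s16]; simp
lemma g1_zero (m : ℕ) : g1 m 0 = ca m 0 := by rw [g1, Finset.sum_range_succ']; simp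
lemma h1_zero (m : ℕ) : h1 m 0 = 0 := by
  rw [h1, Finset.sum_range_succ']
  simp
  refine Finset.sum_eq_zero fun i _ => ?_
  rw [show 2*(i+1)-1 = 2*i+1 by omega]
  simp
lemma hp_zero (m : ℕ) : hp m 0 = cb m 0 := by rw [hp_eq_s16, Finset.sum_range_succ']; simp

lemma wr (m : ℕ) (x : ℝ) :
    hp m x * g1 m x - gp m x * h1 m x + x * (gp m x * hp m x) - gp m x * gp m x = (2*m+1)! := by
  have hd : ∀ y, HasDerivAt (fun x => hp m x * g1 m x - gp m x * h1 m x + x * (gp m x * hp m x) - gp m x * gp m x) 0 y := by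
    intro y
    convert! ((((hd_h m y).fun_mul (hd_g1 m y)).fun_sub ((hd_g m y).fun_mul (hd_h1 m y))).fun_add
      ((hasDerivAt_id' y).fun_mul ((hd_g m y).fun_mul (hd_h m y)))).fun_sub ((hd_g m y).fun_mul (hd_g m y)) using 1
    rw [g_ode, h_ode]
    ring
  have := is_const_of_deriv_eq_zero (fun y => (hd y).differentiableAt) (fun y => (hd y).deriv) x 0
  simp only [gp_zero, g1_zero, h1_zero, hp_zero] at this
  rw [this, ← cb_ca_zero]
  ring

noncomputable def GG (m : ℕ) (x : ℝ) : ℝ := g1 m x + x * gp m x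

lemma hd_GG (m : ℕ) (x : ℝ) : HasDerivAt (GG m) ((2*m+2) * gp m x) x := by
  convert! (hd_g1 m x).fun_add ((hasDerivAt_id' x).fun_mul (hd_g m x)) using 1
  rw [g_ode]
  ring

lemma GG_zero (m : ℕ) : GG m 0 = ca m 0 := by simp [GG, g1_zero]

lemma GG_pos (m : ℕ) (x : ℝ) (hx : 0 ≤ x) : 0 < GG m x := by
  have : MonotoneOn (GG m) (Set.Ici 0) := by
    refine monotoneOn_of_hasDerivWithinAt_nonneg (convex_Ici 0)
      (fun x _ => (hd_GG m x).continuousAt.continuousWithinAt)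
      (fun x _ => (hd_GG m x).hasDerivWithinAt) ?_
    intro y hy
    rw [interior_Ici] at hy
    have := gp_nonneg m y (le_of_lt hy)
    positivity
  have := this (Set.mem_Ici.2 le_rfl) (Set.mem_Ici.2 hx) hx
  rw [GG_zero] at this
  linarith [ca_pos m 0]

lemma hd_exp4 (x : ℝ) : HasDerivAt (fun x : ℝ => Real.exp (x^2/4)) (x/2 * Real.exp (x^2/4)) x := by
  convert! ((hasDerivAt_pow 2 x).div_const 4).exp using 1
  simp; ring

lemma D_lower (m : ℕ) (l : ℝ) (hl2 : l^2 = 2*m+2+1/2) (x : ℝ) (hx : 0 ≤ x) :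
    ca m 0 * Real.cosh (l*x) ≤ GG m x * Real.exp (x^2/4) := by
  have hc : ∀ y, HasDerivAt (fun y => Real.cosh (l*y)) (l * Real.sinh (l*y)) y := by
    intro y
    convert! ((hasDerivAt_id' y).const_mul l).cosh using 1
    ring
  have hs : ∀ y, HasDerivAt (fun y => Real.sinh (l*y)) (l * Real.cosh (l*y)) y := by
    intro y
    convert! ((hasDerivAt_id' y).const_mul l).sinh using 1
    ring
  have hD : ∀ y, HasDerivAt (fun y => GG m y * Real.exp (y^2/4))
      (((2*m+2) * gp m y + y/2 * GG m y) * Real.exp (y^2/4)) y := by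
    intro y
    convert! (hd_GG m y).fun_mul (hd_exp4 y) using 1
    ring
  have hD1 : ∀ y, HasDerivAt (fun y => ((2*m+2) * gp m y + y/2 * GG m y) * Real.exp (y^2/4))
      ((l^2 + y^2/4) * (GG m y * Real.exp (y^2/4))) y := by
    intro y
    convert! (((hd_g m y).const_mul (2*m+2:ℝ)).fun_add (((hasDerivAt_id' y).div_const 2).fun_mul (hd_GG m y))).fun_mul (hd_exp4 y) using 1
    rw [hl2, GG]
    ring
  have hV : ∀ y, HasDerivAt (fun y => ((2*m+2) * gp m y + y/2 * GG m y) * Real.exp (y^2/4) * Real.cosh (l*y)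
      - GG m y * Real.exp (y^2/4) * (l * Real.sinh (l*y))) (y^2/4 * (GG m y * Real.exp (y^2/4)) * Real.cosh (l*y)) y := by
    intro y
    convert! ((hD1 y).fun_mul (hc y)).fun_sub ((hD y).fun_mul ((hs y).const_mul l)) using 1
    ring
  have hVm := monotoneOn_of_hasDerivWithinAt_nonneg (convex_Ici (0:ℝ))
      (fun x _ => (hV x).continuousAt.continuousWithinAt)
      (fun x _ => (hV x).hasDerivWithinAt) (by
        intro y hy
        rw [interior_Ici] at hy
        have := GG_pos m y (le_of_lt hy)
        have := Real.cosh_pos (l*y)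
        positivity)
  have hV0 : ∀ y, 0 ≤ y → 0 ≤ ((2*m+2) * gp m y + y/2 * GG m y) * Real.exp (y^2/4) * Real.cosh (l*y)
      - GG m y * Real.exp (y^2/4) * (l * Real.sinh (l*y)) := by
    intro y hy
    have := hVm (Set.mem_Ici.2 le_rfl) (Set.mem_Ici.2 hy) hy
    simpa [gp_zero] using this
  have hQ : ∀ y, HasDerivAt (fun y => GG m y * Real.exp (y^2/4) / Real.cosh (l*y)) ((((2*m+2) * gp m y + y/2 * GG m y) * Real.exp (y^2/4) * Real.cosh (l*y)
      - GG m y * Real.exp (y^2/4) * (l * Real.sinh (l*y))) / Real.cosh (l*y)^2) y := by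
    intro y
    exact (hD y).fun_div (hc y) (Real.cosh_pos _).ne'
  have hQm := monotoneOn_of_hasDerivWithinAt_nonneg (convex_Ici (0:ℝ))
      (fun x _ => (hQ x).continuousAt.continuousWithinAt)
      (fun x _ => (hQ x).hasDerivWithinAt) (by
        intro y hy
        rw [interior_Ici] at hy
        exact div_nonneg (hV0 y (le_of_lt hy)) (sq_nonneg _))
  have := hQm (Set.mem_Ici.2 le_rfl) (Set.mem_Ici.2 hx) hx
  simp only [GG_zero] at this
  rw [le_div_iff₀ (Real.cosh_pos _)] at this
  simpa using this

lemma integ_gauss : Integrable (fun t : ℝ => Real.exp (-t^2/2)) := by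
  have := integrable_exp_neg_mul_sq (b := 1/2) (by norm_num)
  refine this.congr (Filter.Eventually.of_forall fun t => ?_)
  simp only
  congr 1
  ring

lemma hd_R (x : ℝ) : HasDerivAt (fun x => ∫ t in Set.Ioi x, Real.exp (-t^2/2)) (-Real.exp (-x^2/2)) x := by
  have hc : Continuous (fun t : ℝ => Real.exp (-t^2/2)) := by fun_prop
  have h : (fun x => ∫ t in Set.Ioi x, Real.exp (-t^2/2)) =
      fun x => (∫ t in Set.Ioi (0:ℝ), Real.exp (-t^2/2)) - ∫ t in (0:ℝ)..x, Real.exp (-t^2/2) := by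
    funext y
    rw [← intervalIntegral.integral_Ioi_sub_Ioi' integ_gauss.integrableOn integ_gauss.integrableOn]
    ring
  rw [h]
  have := intervalIntegral.integral_hasDerivAt_right (hc.intervalIntegrable 0 x)
    (hc.stronglyMeasurableAtFilter _ _) hc.continuousAt
  exact this.const_sub _

lemma R_tendsto : Filter.Tendsto (fun x : ℝ => ∫ t in Set.Ioi x, Real.exp (-t^2/2)) Filter.atTop (nhds 0) :=
  tendsto_integral_Ioi_zero Filter.tendsto_id

lemma hd_exp2 (x : ℝ) : HasDerivAt (fun x : ℝ => Real.exp (-x^2/2)) (-x * Real.exp (-x^2/2)) x := by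
  convert! (((hasDerivAt_pow 2 x).neg).div_const 2).exp using 1
  simp; ring

noncomputable def EE (m : ℕ) (x : ℝ) : ℝ :=
  (∫ t in Set.Ioi x, Real.exp (-t^2/2)) - (h1 m x + gp m x) / GG m x * Real.exp (-x^2/2)

lemma hd_EE (m : ℕ) (x : ℝ) (hx : 0 ≤ x) :
    HasDerivAt (EE m) (-((2*m+2)*(2*m+1)! / (GG m x)^2 * Real.exp (-x^2/2))) x := by
  have hG := GG_pos m x hx
  convert! (hd_R x).fun_sub ((((hd_h1 m x).fun_add (hd_g m x)).fun_div (hd_GG m x) hG.ne').fun_mul (hd_exp2 x)) using 1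
  rw [← wr m x, h_ode]
  field_simp
  simp only [GG]
  ring

lemma EE_le_R (m : ℕ) (x : ℝ) (hx : 0 ≤ x) : EE m x ≤ ∫ t in Set.Ioi x, Real.exp (-t^2/2) := by
  have := GG_pos m x hx
  have := h1_nonneg m x hx
  have := gp_nonneg m x hx
  unfold EE
  have : 0 ≤ (h1 m x + gp m x) / GG m x * Real.exp (-x^2/2) := by positivity
  linarith

lemma hd_T (c l x : ℝ) : HasDerivAt (fun x => 2 * c / (Real.exp (2*l*x) + 1)) (- (c * l / Real.cosh (l*x)^2)) x := by
  have he : HasDerivAt (fun x => Real.exp (2*l*x) + 1) (2*l*Real.exp (2*l*x)) x := by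
    have := ((hasDerivAt_id' x).const_mul (2*l)).exp.add_const 1
    convert! this using 1
    ring
  have hp : Real.exp (2*l*x) + 1 ≠ 0 := by positivity
  convert! (hasDerivAt_const x (2*c)).fun_div he hp using 1
  rw [Real.cosh_eq, show 2*l*x = l*x+l*x by ring, Real.exp_add, Real.exp_neg]
  have := Real.exp_pos (l*x)
  field_simp
  ring

lemma EE_le (m : ℕ) (l : ℝ) (hl : 0 < l) (hl2 : l^2 = 2*m+2+1/2) (x : ℝ) (hx : 0 ≤ x) :
    EE m x ≤ 2 * ((2*m+2)*(2*m+1)! / (ca m 0)^2 / l) / (Real.exp (2*l*x) + 1) := by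
  set c : ℝ := (2*m+2)*(2*m+1)! / (ca m 0)^2 / l with hc
  have ha := ca_pos m 0
  have hcpos : 0 < c := by positivity
  have hd : ∀ y, 0 ≤ y → HasDerivAt (fun y => EE m y - 2 * c / (Real.exp (2*l*y) + 1))
      (-((2*m+2)*(2*m+1)! / (GG m y)^2 * Real.exp (-y^2/2)) - (- (c * l / Real.cosh (l*y)^2))) y :=
    fun y hy => (hd_EE m y hy).fun_sub (hd_T c l y)
  have hm := monotoneOn_of_hasDerivWithinAt_nonneg (convex_Ici (0:ℝ))
      (fun x hx => (hd x hx).continuousAt.continuousWithinAt)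
      (fun x hx => (hd x (interior_subset hx)).hasDerivWithinAt) (by
        intro y hy
        have hy := interior_subset hy
        have h1 := D_lower m l hl2 y hy
        have hG := GG_pos m y hy
        have hcl : c * l = (2*m+2)*(2*m+1)! / (ca m 0)^2 := by rw [hc]; field_simp
        have hco := Real.cosh_pos (l*y)
        have h2 : (ca m 0 * Real.cosh (l*y))^2 ≤ (GG m y * Real.exp (y^2/4))^2 := by gcongr
        rw [mul_pow, mul_pow, ← Real.exp_nat_mul, show ((2:ℕ):ℝ) * (y^2/4) = y^2/2 by push_cast; ring] at h2
        have h3 : 1 / (GG m y)^2 * Real.exp (-y^2/2) ≤ 1 / ((ca m 0)^2 * Real.cosh (l*y)^2) := by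
          rw [neg_div, Real.exp_neg, ← div_eq_mul_inv, div_div]
          gcongr
        have h4 : 0 ≤ ((2*m+2)*(2*m+1)! : ℝ) := by positivity
        have h5 := mul_le_mul_of_nonneg_left h3 h4
        rw [hcl]
        have e1 : ((2*m+2)*(2*m+1)! : ℝ) / (GG m y)^2 * Real.exp (-y^2/2) = ((2*m+2)*(2*m+1)! : ℝ) * (1 / (GG m y)^2 * Real.exp (-y^2/2)) := by ring
        have e2 : ((2*m+2)*(2*m+1)! : ℝ) / (ca m 0)^2 / Real.cosh (l*y)^2 = ((2*m+2)*(2*m+1)! : ℝ) * (1 / ((ca m 0)^2 * Real.cosh (l*y)^2)) := by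
          rw [div_div]; ring
        rw [e1, e2]
        linarith)
  have hlim : EE m x - 2 * c / (Real.exp (2*l*x) + 1) ≤ 0 := by
    refine ge_of_tendsto R_tendsto ?_
    filter_upwards [Filter.eventually_ge_atTop x] with y hy
    have h1 := hm (Set.mem_Ici.2 hx) (Set.mem_Ici.2 (hx.trans hy)) hy
    have h2 := EE_le_R m y (hx.trans hy)
    have h3 : 0 ≤ 2 * c / (Real.exp (2*l*y) + 1) := by positivity
    simp only at h1
    linarith
  linarith

lemma wallis_bd (n : ℕ) : (4^n * (n ! : ℝ)^2 / (2*n)!)^2 ≤ π / 2 * (2*n+1) := by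
  have h := Real.Wallis.W_le n
  rw [Real.Wallis.W_eq_factorial_ratio, ← div_div, div_le_iff₀ (by positivity)] at h
  refine le_of_eq_of_le ?_ h
  have e : ((4:ℝ)^n)^2 = 2^(4*n) := by
    rw [← pow_mul, mul_comm n 2, pow_mul, pow_mul]
    norm_num
  rw [div_pow, mul_pow, e, ← pow_mul]

lemma const_bd (n k : ℕ) (hn : 1 ≤ n) (hk1 : 1 ≤ k) (hk2 : k ≤ n) (l : ℝ) (hl : 0 < l) (hl2 : l^2 = 2*n+1/2) :
    2 * ((4^n * (n ! : ℝ)^2 / (2*n)!) / l) * (n ! * 2^(3*k)) ≤ √(2*π) * (n-k)! * (2*l)^(2*k) := by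
  set C : ℝ := 4^n * (n ! : ℝ)^2 / (2*n)! with hC
  have hC0 : 0 ≤ C := by positivity
  have hw : C^2 ≤ π / 2 * (2*n+1) := wallis_bd n
  have hf : (n ! : ℝ) ≤ (n-k)! * (n:ℝ)^k := by
    rw [← Nat.factorial_mul_descFactorial hk2]
    push_cast
    gcongr
    exact_mod_cast Nat.descFactorial_le_pow n k
  have hn' : (1:ℝ) ≤ n := by exact_mod_cast hn
  have key : 2 * C / l * (8*n) ≤ √(2*π) * (8*n+2) := by
    refine le_of_sq_le_sq ?_ (by positivity)
    rw [mul_pow (2*C/l), mul_pow √(2*π), div_pow, mul_pow 2 C, hl2, Real.sq_sqrt (by positivity)]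
    rw [div_mul_eq_mul_div, div_le_iff₀ (by positivity)]
    have h1 : 2^2 * C^2 * (8*n)^2 ≤ 2^2 * (π / 2 * (2*n+1)) * (8*n)^2 := by gcongr
    refine h1.trans ?_
    have : 2^2 * (1 / 2 * (2*n+1)) * (8*n)^2 ≤ 2 * (8*n+2:ℝ)^2 * (2*n+1/2) := by nlinarith
    nlinarith [mul_le_mul_of_nonneg_left this Real.pi_pos.le]
  have hpow : 2 * C / l * (8*n)^k ≤ √(2*π) * (8*n+2)^k := by
    obtain ⟨j, rfl⟩ := Nat.exists_eq_add_of_le hk1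
    rw [pow_add, pow_add, pow_one, pow_one, ← mul_assoc (2*C/l), ← mul_assoc √(2*π)]
    refine mul_le_mul key ?_ (by positivity) (by positivity)
    gcongr
    linarith
  rw [pow_mul (2*l) 2 k, mul_pow, hl2, pow_mul]
  have e : (2^2 * (2*n+1/2) : ℝ) = 8*n+2 := by ring
  rw [e]
  calc 2 * (C/l) * (n ! * (2^3)^k) ≤ 2 * (C/l) * (((n-k)! * (n:ℝ)^k) * (2^3)^k) := by gcongr
    _ = (n-k)! * (2 * C / l * (8*n)^k) := by rw [mul_pow]; norm_num; ring
    _ ≤ (n-k)! * (√(2*π) * (8*n+2)^k) := by gcongr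
    _ = _ := by ring

theorem stmt16 (n : ℕ) (hn : 1 ≤ n) (x : ℝ) (hx : 0 < x)
    (k : ℕ) (hk1 : 1 ≤ k) (hk2 : k ≤ n) :
    (∫ t in Set.Ioi x, Real.exp (-t^2/2))
        - (deriv (hp (n-1)) x + gp (n-1) x)
          / (deriv (gp (n-1)) x + x * gp (n-1) x) * Real.exp (-x^2/2)
      < Real.sqrt (2*Real.pi) * (2*k)! * (n-k)! / (x^(2*k) * 2^(3*k) * n !) := by
  rw [(hd_h (n-1) x).deriv, (hd_g (n-1) x).deriv]
  change EE (n-1) x < _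
  obtain ⟨m, rfl⟩ : ∃ m, n = m + 1 := ⟨n - 1, by omega⟩
  rw [Nat.add_sub_cancel]
  have hl : 0 < √(2*m+2+1/2 : ℝ) := by positivity
  have hl2 : √(2*m+2+1/2 : ℝ)^2 = 2*m+2+1/2 := Real.sq_sqrt (by positivity)
  generalize √(2*m+2+1/2 : ℝ) = l at hl hl2
  have h1 := EE_le m l hl hl2 x hx.le
  rw [ca_zero_sq] at h1
  have h2 := const_bd (m+1) k hn hk1 hk2 l hl (by rw [hl2]; push_cast; ring)
  have hA : 0 < 2 * ((4^(m+1) * ((m+1)! : ℝ)^2 / (2*(m+1))!) / l) := by positivity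
  generalize 2 * ((4^(m+1) * ((m+1)! : ℝ)^2 / (2*(m+1))!) / l) = A at h1 h2 hA
  refine h1.trans_lt ?_
  have h3 := Real.pow_div_factorial_le_exp (x := 2*l*x) (by positivity) (2*k)
  rw [div_le_iff₀ (by positivity), mul_pow] at h3
  rw [div_lt_div_iff₀ (by positivity) (by positivity)]
  have hf : (0:ℝ) < (2*k)! := by positivity
  have hs : 0 < √(2*π) := by positivity
  calc A * (x^(2*k) * 2^(3*k) * (m+1)!) = A * ((m+1)! * 2^(3*k)) * x^(2*k) := by ring
    _ ≤ √(2*π) * (m+1-k)! * (2*l)^(2*k) * x^(2*k) := by gcongr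
    _ = √(2*π) * (m+1-k)! * ((2*l)^(2*k) * x^(2*k)) := by ring
    _ ≤ √(2*π) * (m+1-k)! * (Real.exp (2*l*x) * (2*k)!) := by gcongr
    _ = √(2*π) * (2*k)! * (m+1-k)! * Real.exp (2*l*x) := by ring
    _ < √(2*π) * (2*k)! * (m+1-k)! * (Real.exp (2*l*x) + 1) := by
      gcongr
      linarith
end
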